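/- arXiv:2405.08600 — 2 statements merged into one kernel-verified Lean document; each statement's English description precedes it below -/
import Mathlib

section
/- Let n ≥ 1; let λ > 0, μ > 0, q ∈ ℝ; let η⁺, η⁻ : [0,1] → ℝ be continuous; let A be a real n×n matrix, B ∈ ℝⁿ, M ∈ ℝⁿ. Let Kuu, Kuv, Kvu, Kvv be continuously differentiable real functions on the triangle T = {(x,y) : 0 ≤ y ≤ x ≤ 1}, and γα, γβ : [0,1] → ℝⁿ continuously differentiable, satisfying the kernel equations: (i) λ∂ₓKuu + λ∂ᵧKuu + η⁻(y)Kuv = 0, λ∂ₓKuv − μ∂ᵧKuv + η⁺(y)Kuu = 0, −μ∂ₓKvu + λ∂ᵧKvu + η⁻(y)Kvv = 0, −μ∂ₓKvv − μ∂ᵧKvv + η⁺(y)Kvu = 0 on T; (ii) (λ+μ)Kuv(x,x) = −η⁺(x) and (λ+μ)Kvu(x,x) = η⁻(x) for x ∈ [0,1]; (iii) λγα′(x) + Aᵀγα(x) + λKuu(x,0)M = 0 and −μγβ′(x) + Aᵀγβ(x) + λKvu(x,0)M = 0 on [0,1]; (iv) λqKuu(x,0) − μKuv(x,0) + γα(x)·B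 = 0 and λqKvu(x,0) − μKvv(x,0) + γβ(x)·B = 0 on [0,1]; (v) γα(0) = −M and γβ(0) = 0. Suppose u, v : [0,∞) × [0,1] → ℝ are continuously differentiable and X : [0,∞) → ℝⁿ is differentiable, with ∂ₜu + λ∂ₓu = η⁺(x)v, ∂ₜv − μ∂ₓv = η⁻(x)u, X′(t) = A X(t) + v(t,0)·B, and u(t,0) = q v(t,0) + M·X(t) for all t ≥ 0, x ∈ [0,1]. Define α(t,x) = u(t,x) + ∫₀ˣ (Kuu(x,y)u(t,y) + Kuv(x,y)v(t,y)) dy + γα(x)·X(t) and β(t,x) = v(t,x) + ∫₀ˣ (Kvu(x,y)u(t,y) + Kvv(x,y)v(t,y)) dy + γβ(x)·X(t). Then for all t > 0 and x ∈ [0,1]: ∂ₜα(t,x) + λ∂ₓα(t,x) = 0, ∂ₜβ(t,x) − μ∂ₓβ(t,x) = 0, β(t,0) = v(t,0), and α(t,0) = q β(t,0). -/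
open Matrix MeasureTheory intervalIntegral

/-- The triangular domain `T = {(x,y) : 0 ≤ y ≤ x ≤ 1}` on which the
backstepping kernels are defined. -/
def backsteppingTriangle : Set (ℝ × ℝ) :=
  {p : ℝ × ℝ | 0 ≤ p.2 ∧ p.2 ≤ p.1 ∧ p.1 ≤ 1}

open Set

/-- Differentiation under the integral sign over a compact interval, for an integrand which is
continuous together with its derivative in the parameter. -/
theorem hasDerivAt_integral_of_continuousOn_deriv {f f' : ℝ → ℝ → ℝ} {p r a b t : ℝ} (hab : a ≤ b)
    (ht : t ∈ Ioo p r)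
    (hf : ContinuousOn (fun z : ℝ × ℝ => f z.1 z.2) (Icc p r ×ˢ Icc a b))
    (hf' : ContinuousOn (fun z : ℝ × ℝ => f' z.1 z.2) (Icc p r ×ˢ Icc a b))
    (hd : ∀ s ∈ Ioo p r, ∀ y ∈ Icc a b, HasDerivAt (fun τ => f τ y) (f' s y) s) :
    HasDerivAt (fun τ => ∫ y in a..b, f τ y) (∫ y in a..b, f' t y) t := by
  have hsub : uIoc a b ⊆ Icc a b := by rw [uIoc_of_le hab]; exact Ioc_subset_Icc_self
  have slice : ∀ {g : ℝ → ℝ → ℝ},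
      ContinuousOn (fun z : ℝ × ℝ => g z.1 z.2) (Icc p r ×ˢ Icc a b) →
      ∀ s ∈ Icc p r, ContinuousOn (g s) (Icc a b) := fun hg s hs =>
    hg.comp (f := fun y => (s, y)) (by fun_prop) fun y hy => ⟨hs, hy⟩
  have meas : ∀ {g : ℝ → ℝ}, ContinuousOn g (Icc a b) →
      AEStronglyMeasurable g (volume.restrict (uIoc a b)) := fun hg =>
    (hg.mono hsub).aestronglyMeasurable measurableSet_uIoc
  obtain ⟨C, hC⟩ := (isCompact_Icc.prod isCompact_Icc).exists_bound_of_continuousOn hf'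
  refine (intervalIntegral.hasDerivAt_integral_of_dominated_loc_of_deriv_le
    (F' := f') (bound := fun _ => C) (Ioo_mem_nhds ht.1 ht.2) ?_ ?_ ?_ ?_
    intervalIntegrable_const ?_).2
  · filter_upwards [Ioo_mem_nhds ht.1 ht.2] with s hs
    exact meas (slice hf s (Ioo_subset_Icc_self hs))
  · exact (slice hf t (Ioo_subset_Icc_self ht)).intervalIntegrable_of_Icc hab
  · exact meas (slice hf' t (Ioo_subset_Icc_self ht))
  · exact .of_forall fun y hy s hs => hC (s, y) ⟨Ioo_subset_Icc_self hs, hsub hy⟩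
  · exact .of_forall fun y hy s hs => hd s hs y (hsub hy)

/-- The Leibniz rule for an integral whose upper limit is also the parameter. -/
theorem hasDerivAt_integral_diagonal {F F' : ℝ → ℝ → ℝ}
    (hF : Continuous fun z : ℝ × ℝ => F z.1 z.2) (hF' : Continuous fun z : ℝ × ℝ => F' z.1 z.2)
    (hd : ∀ x y, HasDerivAt (fun ξ => F ξ y) (F' x y) x) {x : ℝ} :
    HasDerivAt (fun ξ => ∫ y in (0 : ℝ)..ξ, F ξ y) (F x x + ∫ y in (0 : ℝ)..x, F' x y) x := by
  have h1 : ∀ a b, HasDerivAt (fun s => ∫ y in (0 : ℝ)..s, F b y) (F b a) a := fun a b =>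
    (show Continuous (F b) by fun_prop).integral_hasStrictDerivAt 0 a |>.hasDerivAt
  have h2 : ∀ a b, HasDerivAt (fun s => ∫ y in (0 : ℝ)..a, F s y)
      (∫ y in (0 : ℝ)..a, F' b y) b := by
    intro a b
    have key : ∀ {p q : ℝ}, p ≤ q →
        HasDerivAt (fun s => ∫ y in p..q, F s y) (∫ y in p..q, F' b y) b := fun hpq =>
      hasDerivAt_integral_of_continuousOn_deriv hpq (p := b - 1) (r := b + 1)
        ⟨by linarith, by linarith⟩ hF.continuousOn hF'.continuousOn fun s _ y _ => hd s y
    rcases le_total 0 a with h | h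
    · exact key h
    · simp_rw [integral_symm a 0]
      exact (key h).neg
  have hc : Continuous fun z : ℝ × ℝ => ∫ y in (0 : ℝ)..z.1, F' z.2 y :=
    continuous_parametric_intervalIntegral_of_continuous (by fun_prop) continuous_fst
  have hs := hasStrictFDerivAt_uncurry_coprod (u := (x, x))
    (f := fun a b => ∫ y in (0 : ℝ)..a, F b y)
    (f₁ := fun a b => ContinuousLinearMap.toSpanSingleton ℝ (F b a))
    (f₂ := fun a b => ContinuousLinearMap.toSpanSingleton ℝ (∫ y in (0 : ℝ)..a, F' b y))
    (.of_forall fun v => (h1 v.1 v.2).hasFDerivAt) (.of_forall fun v => (h2 v.1 v.2).hasFDerivAt)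
    ((ContinuousLinearMap.toSpanSingletonCLE (𝕜 := ℝ) (E := ℝ)).continuous.comp
      (show Continuous fun z : ℝ × ℝ => F z.2 z.1 by fun_prop)).continuousAt
    ((ContinuousLinearMap.toSpanSingletonCLE (𝕜 := ℝ) (E := ℝ)).continuous.comp hc).continuousAt
  have := hs.hasFDerivAt.comp_hasDerivAt (f := fun ξ => (ξ, ξ)) x ((hasDerivAt_id x).prodMk (hasDerivAt_id x))
  simpa [Function.comp_def, Function.HasUncurry.uncurry] using this

/-- A function on the triangle which is `C¹` in its first variable extends to the whole plane. -/
theorem exists_extension_of_triangle {G g : ℝ → ℝ → ℝ}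
    (hG : ContinuousOn (fun z : ℝ × ℝ => G z.1 z.2) backsteppingTriangle)
    (hg : ContinuousOn (fun z : ℝ × ℝ => g z.1 z.2) backsteppingTriangle)
    (hd : ∀ x y : ℝ, (x, y) ∈ backsteppingTriangle →
      HasDerivWithinAt (fun ξ => G ξ y) (g x y) (Icc y 1) x) :
    ∃ F F' : ℝ → ℝ → ℝ, Continuous (fun z : ℝ × ℝ => F z.1 z.2) ∧
      Continuous (fun z : ℝ × ℝ => F' z.1 z.2) ∧
      (∀ x y, HasDerivAt (fun ξ => F ξ y) (F' x y) x) ∧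
      ∀ x y : ℝ, (x, y) ∈ backsteppingTriangle → F x y = G x y ∧ F' x y = g x y := by
  let c : ℝ → ℝ := fun y => max 0 (min y 1)
  have hc : Continuous c := by fun_prop
  have hc0 : ∀ y, 0 ≤ c y := fun y => le_max_left _ _
  have hc1 : ∀ y, c y ≤ 1 := fun y => max_le zero_le_one (min_le_right _ _)
  have hcy : ∀ y, 0 ≤ y → y ≤ 1 → c y = y := fun y h0 h1 => by simp [c, h0, h1]
  let F' : ℝ → ℝ → ℝ := fun s y => g (max (c s) (c y)) (c y)
  have hF' : Continuous fun z : ℝ × ℝ => F' z.1 z.2 :=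
    hg.comp_continuous (f := fun z : ℝ × ℝ => (max (c z.1) (c z.2), c z.2)) (by fun_prop)
      fun z => ⟨hc0 _, le_max_right _ _, max_le (hc1 _) (hc1 _)⟩
  have hdiag : Continuous fun y => G (c y) (c y) :=
    hG.comp_continuous (f := fun y : ℝ => (c y, c y)) (by fun_prop)
      fun y => ⟨hc0 _, le_rfl, hc1 _⟩
  have hslice : ∀ y, Continuous fun s => F' s y := fun y => by
    exact hF'.comp (show Continuous fun s : ℝ => (s, y) by fun_prop)
  refine ⟨fun x y => G (c y) (c y) + ∫ s in c y..x, F' s y, F', ?_, hF', ?_, ?_⟩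
  · have hsplit : ∀ z : ℝ × ℝ, ∫ s in c z.2..z.1, F' s z.2 =
        (∫ s in (0 : ℝ)..z.1, F' s z.2) - ∫ s in (0 : ℝ)..c z.2, F' s z.2 := fun z =>
      (integral_interval_sub_left ((hslice z.2).intervalIntegrable _ _)
        ((hslice z.2).intervalIntegrable _ _)).symm
    simp_rw [hsplit]
    have hp : Continuous (Function.uncurry fun (z : ℝ × ℝ) (s : ℝ) => F' s z.2) :=
      hF'.comp (show Continuous fun w : (ℝ × ℝ) × ℝ => (w.2, w.1.2) by fun_prop)
    exact (hdiag.comp continuous_snd).add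
      ((continuous_parametric_intervalIntegral_of_continuous hp continuous_fst).sub
        (continuous_parametric_intervalIntegral_of_continuous hp (hc.comp continuous_snd)))
  · intro x y
    exact (((hslice y).integral_hasStrictDerivAt (c y) x).hasDerivAt).const_add _
  · rintro x y ⟨h0, h1, h2⟩
    have hy : c y = y := hcy y h0 (h1.trans h2)
    have hFg : ∀ s ∈ Icc y x, F' s y = g s y := fun s hs => by
      simp only [F', hy, hcy s (h0.trans hs.1) (hs.2.trans h2), max_eq_left hs.1]
    refine ⟨?_, hFg x ⟨h1, le_rfl⟩⟩
    have hint : ∫ s in y..x, F' s y = G x y - G y y := by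
      refine integral_eq_sub_of_hasDerivAt_of_le h1 (f := fun s => G s y) ?_ ?_
        ((hslice y).intervalIntegrable _ _)
      · exact hG.comp (f := fun s : ℝ => (s, y)) (by fun_prop)
          fun s hs => ⟨h0, hs.1, hs.2.trans h2⟩
      · intro s hs
        rw [hFg s (Ioo_subset_Icc_self hs)]
        exact (hd s y ⟨h0, hs.1.le, hs.2.le.trans h2⟩).hasDerivAt
          (Icc_mem_nhds hs.1 (hs.2.trans_le h2))
    simp only [hy, hint]
    ring

/-- The Leibniz rule for Volterra integrals with an integrand defined on the triangle. -/
theorem hasDerivWithinAt_volterra_integral {G g : ℝ → ℝ → ℝ}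
    (hG : ContinuousOn (fun z : ℝ × ℝ => G z.1 z.2) backsteppingTriangle)
    (hg : ContinuousOn (fun z : ℝ × ℝ => g z.1 z.2) backsteppingTriangle)
    (hd : ∀ x y : ℝ, (x, y) ∈ backsteppingTriangle →
      HasDerivWithinAt (fun ξ => G ξ y) (g x y) (Icc y 1) x)
    {x : ℝ} (hx : x ∈ Icc (0 : ℝ) 1) :
    HasDerivWithinAt (fun ξ => ∫ y in (0 : ℝ)..ξ, G ξ y) (G x x + ∫ y in (0 : ℝ)..x, g x y)
      (Icc 0 1) x := by
  obtain ⟨F, F', hF, hF', hFd, hFG⟩ := exists_extension_of_triangle hG hg hd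
  have hmem : ∀ ξ ∈ Icc (0 : ℝ) 1, ∀ y ∈ uIcc 0 ξ, (ξ, y) ∈ backsteppingTriangle := by
    intro ξ hξ y hy
    rw [uIcc_of_le hξ.1] at hy
    exact ⟨hy.1, hy.2, hξ.2⟩
  have hval : ∀ ξ ∈ Icc (0 : ℝ) 1, ∫ y in (0 : ℝ)..ξ, G ξ y = ∫ y in (0 : ℝ)..ξ, F ξ y :=
    fun ξ hξ => integral_congr fun y hy => ((hFG ξ y (hmem ξ hξ y hy)).1).symm
  have hder : ∫ y in (0 : ℝ)..x, g x y = ∫ y in (0 : ℝ)..x, F' x y :=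
    integral_congr fun y hy => ((hFG x y (hmem x hx y hy)).2).symm
  rw [hder, ← (hFG x x ⟨hx.1, le_rfl, hx.2⟩).1]
  exact (hasDerivAt_integral_diagonal hF hF' hFd).hasDerivWithinAt.congr hval (hval x hx)

/-- One component of the backstepping transformation is transported with speed `c`. -/
theorem backstepping_component_transport {n : ℕ} {c lam μ q : ℝ} {ηp ηm : ℝ → ℝ}
    {A : Matrix (Fin n) (Fin n) ℝ} {B M : Fin n → ℝ} {K L Kx Lx Ky Ly : ℝ → ℝ → ℝ}
    (hKx : ∀ x y : ℝ, (x, y) ∈ backsteppingTriangle →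
      HasDerivWithinAt (fun ξ => K ξ y) (Kx x y) (Icc y 1) x)
    (hLx : ∀ x y : ℝ, (x, y) ∈ backsteppingTriangle →
      HasDerivWithinAt (fun ξ => L ξ y) (Lx x y) (Icc y 1) x)
    (hKy : ∀ x y : ℝ, (x, y) ∈ backsteppingTriangle →
      HasDerivWithinAt (fun ζ => K x ζ) (Ky x y) (Icc 0 x) y)
    (hLy : ∀ x y : ℝ, (x, y) ∈ backsteppingTriangle →
      HasDerivWithinAt (fun ζ => L x ζ) (Ly x y) (Icc 0 x) y)
    (hKc : ∀ F ∈ ({K, L, Kx, Lx, Ky, Ly} : Set (ℝ → ℝ → ℝ)),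
      ContinuousOn (fun p : ℝ × ℝ => F p.1 p.2) backsteppingTriangle)
    {γ γ' : ℝ → Fin n → ℝ}
    (hγ : ∀ x ∈ Icc (0 : ℝ) 1, HasDerivWithinAt γ (γ' x) (Icc 0 1) x)
    (hkeq1 : ∀ x y : ℝ, (x, y) ∈ backsteppingTriangle →
      c * Kx x y + lam * Ky x y + ηm y * L x y = 0)
    (hkeq2 : ∀ x y : ℝ, (x, y) ∈ backsteppingTriangle →
      c * Lx x y - μ * Ly x y + ηp y * K x y = 0)
    (hγode : ∀ x ∈ Icc (0 : ℝ) 1, c • γ' x + Aᵀ.mulVec (γ x) + (lam * K x 0) • M = 0)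
    (hbc : ∀ x ∈ Icc (0 : ℝ) 1, lam * q * K x 0 - μ * L x 0 + γ x ⬝ᵥ B = 0)
    {u v ut ux vt vx : ℝ → ℝ → ℝ} {X : ℝ → Fin n → ℝ}
    (hut : ∀ t : ℝ, 0 ≤ t → ∀ x ∈ Icc (0 : ℝ) 1,
      HasDerivWithinAt (fun τ => u τ x) (ut t x) (Ici 0) t)
    (hux : ∀ t : ℝ, 0 ≤ t → ∀ x ∈ Icc (0 : ℝ) 1,
      HasDerivWithinAt (fun ξ => u t ξ) (ux t x) (Icc 0 1) x)
    (hvt : ∀ t : ℝ, 0 ≤ t → ∀ x ∈ Icc (0 : ℝ) 1,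
      HasDerivWithinAt (fun τ => v τ x) (vt t x) (Ici 0) t)
    (hvx : ∀ t : ℝ, 0 ≤ t → ∀ x ∈ Icc (0 : ℝ) 1,
      HasDerivWithinAt (fun ξ => v t ξ) (vx t x) (Icc 0 1) x)
    (huc : ∀ F ∈ ({u, v, ut, ux, vt, vx} : Set (ℝ → ℝ → ℝ)),
      ContinuousOn (fun p : ℝ × ℝ => F p.1 p.2) (Ici 0 ×ˢ Icc 0 1))
    (hpde1 : ∀ t : ℝ, 0 ≤ t → ∀ x ∈ Icc (0 : ℝ) 1, ut t x + lam * ux t x = ηp x * v t x)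
    (hpde2 : ∀ t : ℝ, 0 ≤ t → ∀ x ∈ Icc (0 : ℝ) 1, vt t x - μ * vx t x = ηm x * u t x)
    (hX : ∀ t : ℝ, 0 ≤ t →
      HasDerivWithinAt X (A.mulVec (X t) + v t 0 • B) (Ici 0) t)
    (hbdry : ∀ t : ℝ, 0 ≤ t → u t 0 = q * v t 0 + M ⬝ᵥ X t)
    {w wt wx : ℝ → ℝ → ℝ} {t x : ℝ} (ht : 0 < t) (hx : x ∈ Icc (0 : ℝ) 1)
    (hwt : HasDerivWithinAt (fun τ => w τ x) (wt t x) (Ici 0) t)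
    (hwx : HasDerivWithinAt (fun ξ => w t ξ) (wx t x) (Icc 0 1) x)
    (hdiag : wt t x + c * wx t x + (c - lam) * K x x * u t x + (c + μ) * L x x * v t x = 0) :
    ∃ pt px : ℝ,
      HasDerivAt (fun τ => w τ x + (∫ y in (0 : ℝ)..x, (K x y * u τ y + L x y * v τ y))
        + γ x ⬝ᵥ X τ) pt t ∧
      HasDerivWithinAt (fun ξ => w t ξ + (∫ y in (0 : ℝ)..ξ, (K ξ y * u t y + L ξ y * v t y))
        + γ ξ ⬝ᵥ X t) px (Icc 0 1) x ∧ pt + c * px = 0 := by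
  simp only [mem_insert_iff, mem_singleton_iff, forall_eq_or_imp, forall_eq] at hKc huc
  obtain ⟨cK, cL, cKx, cLx, cKy, cLy⟩ := hKc
  obtain ⟨cu, cv, cut, cux, cvt, cvx⟩ := huc
  have ht0 := ht.le
  have hsub : Icc 0 x ⊆ Icc (0 : ℝ) 1 := Icc_subset_Icc_right hx.2
  have row : ∀ {F : ℝ → ℝ → ℝ}, ContinuousOn (fun p : ℝ × ℝ => F p.1 p.2) backsteppingTriangle →
      ContinuousOn (F x) (Icc 0 x) := fun hF =>
    hF.comp (f := fun y => (x, y)) (by fun_prop) fun y hy => ⟨hy.1, hy.2, hx.2⟩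
  have slice : ∀ {F : ℝ → ℝ → ℝ},
      ContinuousOn (fun p : ℝ × ℝ => F p.1 p.2) (Ici 0 ×ˢ Icc 0 1) →
      ContinuousOn (F t) (Icc 0 1) := fun hF =>
    hF.comp (f := fun y => (t, y)) (by fun_prop) fun y hy => ⟨ht0, hy⟩
  -- the Volterra term, differentiated in space
  have tri : ∀ {f : ℝ → ℝ}, ContinuousOn f (Icc 0 1) →
      ContinuousOn (fun p : ℝ × ℝ => f p.2) backsteppingTriangle := fun hf =>
    hf.comp continuousOn_snd fun p hp => ⟨hp.1, hp.2.1.trans hp.2.2⟩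
  have dx := hasDerivWithinAt_volterra_integral
    (G := fun ξ y => K ξ y * u t y + L ξ y * v t y)
    (g := fun ξ y => Kx ξ y * u t y + Lx ξ y * v t y)
    ((cK.mul (tri (slice cu))).add (cL.mul (tri (slice cv))))
    ((cKx.mul (tri (slice cu))).add (cLx.mul (tri (slice cv))))
    (fun ξ y h => ((hKx ξ y h).mul_const _).add ((hLx ξ y h).mul_const _)) hx
  -- the Volterra term, differentiated in time
  have strip : Icc 0 (t + 1) ×ˢ Icc 0 x ⊆ Ici (0 : ℝ) ×ˢ Icc (0 : ℝ) 1 :=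
    prod_mono Icc_subset_Ici_self hsub
  have lift : ∀ {f : ℝ → ℝ}, ContinuousOn f (Icc 0 x) →
      ContinuousOn (fun p : ℝ × ℝ => f p.2) (Icc 0 (t + 1) ×ˢ Icc 0 x) := fun hf =>
    hf.comp continuousOn_snd fun p hp => hp.2
  have dt := hasDerivAt_integral_of_continuousOn_deriv (p := 0) (r := t + 1) hx.1
    (f := fun τ y => K x y * u τ y + L x y * v τ y)
    (f' := fun τ y => K x y * ut τ y + L x y * vt τ y) ⟨ht, by linarith⟩
    (((lift (row cK)).mul (cu.mono strip)).add ((lift (row cL)).mul (cv.mono strip)))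
    (((lift (row cK)).mul (cut.mono strip)).add ((lift (row cL)).mul (cvt.mono strip)))
    (fun s hs y hy =>
      (((hut s hs.1.le y (hsub hy)).hasDerivAt (Ici_mem_nhds hs.1)).const_mul _).add
        (((hvt s hs.1.le y (hsub hy)).hasDerivAt (Ici_mem_nhds hs.1)).const_mul _))
  -- the finite-dimensional term
  have dγ : HasDerivWithinAt (fun ξ => γ ξ ⬝ᵥ X t) (γ' x ⬝ᵥ X t) (Icc 0 1) x :=
    HasDerivWithinAt.fun_sum fun i _ => (hasDerivWithinAt_pi.1 (hγ x hx) i).mul_const _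
  have dX : HasDerivAt (fun τ => γ x ⬝ᵥ X τ) (γ x ⬝ᵥ (A.mulVec (X t) + v t 0 • B)) t :=
    HasDerivAt.fun_sum fun i _ =>
      (hasDerivAt_pi.1 ((hX t ht0).hasDerivAt (Ici_mem_nhds ht)) i).const_mul _
  refine ⟨_, _, ((hwt.hasDerivAt (Ici_mem_nhds ht)).add dt).add dX, (hwx.add dx).add dγ, ?_⟩
  -- integration by parts
  have parts : ∀ {k k' f f' : ℝ → ℝ}, (∀ y ∈ Icc 0 x, HasDerivWithinAt k (k' y) (Icc 0 x) y) →
      (∀ y ∈ Icc (0 : ℝ) 1, HasDerivWithinAt f (f' y) (Icc 0 1) y) →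
      ContinuousOn k' (Icc 0 x) → ContinuousOn f' (Icc 0 1) →
      ∫ y in (0 : ℝ)..x, (k' y * f y + k y * f' y) = k x * f x - k 0 * f 0 := by
    intro k k' f f' hk hf ck cf
    refine integral_deriv_mul_eq_sub_of_hasDerivWithinAt ?_ ?_
      (ck.intervalIntegrable_of_Icc hx.1) ((cf.mono hsub).intervalIntegrable_of_Icc hx.1)
    · rwa [uIcc_of_le hx.1]
    · rw [uIcc_of_le hx.1]
      exact fun y hy => (hf y (hsub hy)).mono hsub
  have pK := parts (fun y hy => hKy x y ⟨hy.1, hy.2, hx.2⟩) (hux t ht0) (row cKy) (slice cux)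
  have pL := parts (fun y hy => hLy x y ⟨hy.1, hy.2, hx.2⟩) (hvx t ht0) (row cLy) (slice cvx)
  have intble : ∀ {k k' f f' : ℝ → ℝ}, ContinuousOn k (Icc 0 x) → ContinuousOn k' (Icc 0 x) →
      ContinuousOn f (Icc 0 1) → ContinuousOn f' (Icc 0 1) →
      IntervalIntegrable (fun y => k y * f y + k' y * f' y) volume 0 x := fun hk hk' hf hf' =>
    ((hk.mul (hf.mono hsub)).add (hk'.mul (hf'.mono hsub))).intervalIntegrable_of_Icc hx.1
  have hvol : (∫ y in (0 : ℝ)..x, (K x y * ut t y + L x y * vt t y)) +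
      c * (∫ y in (0 : ℝ)..x, (Kx x y * u t y + Lx x y * v t y)) =
      -lam * (K x x * u t x - K x 0 * u t 0) + μ * (L x x * v t x - L x 0 * v t 0) := by
    rw [← pK, ← pL, ← intervalIntegral.integral_const_mul, ← intervalIntegral.integral_const_mul,
      ← intervalIntegral.integral_const_mul, ← intervalIntegral.integral_add,
      ← intervalIntegral.integral_add]
    · refine integral_congr fun y hy => ?_
      rw [uIcc_of_le hx.1] at hy
      have hT : (x, y) ∈ backsteppingTriangle := ⟨hy.1, hy.2, hx.2⟩
      linear_combination K x y * hpde1 t ht0 y (hsub hy) + L x y * hpde2 t ht0 y (hsub hy) +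
        u t y * hkeq1 x y hT + v t y * hkeq2 x y hT
    · exact (intble (row cKy) (row cK) (slice cu) (slice cux)).const_mul _
    · exact (intble (row cLy) (row cL) (slice cv) (slice cvx)).const_mul _
    · exact intble (row cK) (row cL) (slice cut) (slice cvt)
    · exact (intble (row cKx) (row cLx) (slice cu) (slice cv)).const_mul _
  have hode := congrArg (· ⬝ᵥ X t) (hγode x hx)
  simp only [add_dotProduct, smul_dotProduct, zero_dotProduct, smul_eq_mul, mulVec_transpose,
    ← dotProduct_mulVec] at hode
  simp only [dotProduct_add, dotProduct_smul, smul_eq_mul]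
  linear_combination hdiag + hvol + hode + v t 0 * hbc x hx + lam * K x 0 * hbdry t ht0

/-- **Deterministic backstepping transformation for the coupled hyperbolic
PDE–ODE system.** Under the kernel equations (i)–(v), the Volterra-plus-affine
change of variables
`α = u + ∫₀ˣ (Kuu u + Kuv v) + γα ⬝ X`, `β = v + ∫₀ˣ (Kvu u + Kvv v) + γβ ⬝ X`
maps the coupled system into the uncoupled target transport system
`∂ₜα + λ∂ₓα = 0`, `∂ₜβ − μ∂ₓβ = 0` with boundary couplings `β(t,0) = v(t,0)`
and `α(t,0) = q β(t,0)`. -/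
theorem backstepping_target_system
    (n : ℕ) (hn : 1 ≤ n) (lam μ q : ℝ) (hlam : 0 < lam) (hμ : 0 < μ)
    (ηp ηm : ℝ → ℝ) (hηp : ContinuousOn ηp (Set.Icc 0 1)) (hηm : ContinuousOn ηm (Set.Icc 0 1))
    (A : Matrix (Fin n) (Fin n) ℝ) (B : Fin n → ℝ) (M : Fin n → ℝ)
    -- the four kernels, their partial derivatives, and C¹ regularity on the triangle
    (Kuu Kuv Kvu Kvv Kuux Kuvx Kvux Kvvx Kuuy Kuvy Kvuy Kvvy : ℝ → ℝ → ℝ)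
    (hKuux : ∀ x y : ℝ, (x, y) ∈ backsteppingTriangle →
      HasDerivWithinAt (fun ξ => Kuu ξ y) (Kuux x y) (Set.Icc y 1) x)
    (hKuvx : ∀ x y : ℝ, (x, y) ∈ backsteppingTriangle →
      HasDerivWithinAt (fun ξ => Kuv ξ y) (Kuvx x y) (Set.Icc y 1) x)
    (hKvux : ∀ x y : ℝ, (x, y) ∈ backsteppingTriangle →
      HasDerivWithinAt (fun ξ => Kvu ξ y) (Kvux x y) (Set.Icc y 1) x)
    (hKvvx : ∀ x y : ℝ, (x, y) ∈ backsteppingTriangle →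
      HasDerivWithinAt (fun ξ => Kvv ξ y) (Kvvx x y) (Set.Icc y 1) x)
    (hKuuy : ∀ x y : ℝ, (x, y) ∈ backsteppingTriangle →
      HasDerivWithinAt (fun ζ => Kuu x ζ) (Kuuy x y) (Set.Icc 0 x) y)
    (hKuvy : ∀ x y : ℝ, (x, y) ∈ backsteppingTriangle →
      HasDerivWithinAt (fun ζ => Kuv x ζ) (Kuvy x y) (Set.Icc 0 x) y)
    (hKvuy : ∀ x y : ℝ, (x, y) ∈ backsteppingTriangle →
      HasDerivWithinAt (fun ζ => Kvu x ζ) (Kvuy x y) (Set.Icc 0 x) y)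
    (hKvvy : ∀ x y : ℝ, (x, y) ∈ backsteppingTriangle →
      HasDerivWithinAt (fun ζ => Kvv x ζ) (Kvvy x y) (Set.Icc 0 x) y)
    (hKc : ∀ F ∈ ({Kuu, Kuv, Kvu, Kvv, Kuux, Kuvx, Kvux, Kvvx,
        Kuuy, Kuvy, Kvuy, Kvvy} : Set (ℝ → ℝ → ℝ)),
      ContinuousOn (fun p : ℝ × ℝ => F p.1 p.2) backsteppingTriangle)
    -- γα, γβ and their derivatives, C¹ on [0,1]
    (γα γβ γα' γβ' : ℝ → Fin n → ℝ)
    (hγα : ∀ x ∈ Set.Icc (0 : ℝ) 1, HasDerivWithinAt γα (γα' x) (Set.Icc 0 1) x)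
    (hγβ : ∀ x ∈ Set.Icc (0 : ℝ) 1, HasDerivWithinAt γβ (γβ' x) (Set.Icc 0 1) x)
    (hγα'c : ContinuousOn γα' (Set.Icc 0 1)) (hγβ'c : ContinuousOn γβ' (Set.Icc 0 1))
    -- (i) interior kernel equations on T
    (hkeq1 : ∀ x y : ℝ, (x, y) ∈ backsteppingTriangle →
      lam * Kuux x y + lam * Kuuy x y + ηm y * Kuv x y = 0)
    (hkeq2 : ∀ x y : ℝ, (x, y) ∈ backsteppingTriangle →
      lam * Kuvx x y - μ * Kuvy x y + ηp y * Kuu x y = 0)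
    (hkeq3 : ∀ x y : ℝ, (x, y) ∈ backsteppingTriangle →
      -μ * Kvux x y + lam * Kvuy x y + ηm y * Kvv x y = 0)
    (hkeq4 : ∀ x y : ℝ, (x, y) ∈ backsteppingTriangle →
      -μ * Kvvx x y - μ * Kvvy x y + ηp y * Kvu x y = 0)
    -- (ii) diagonal boundary conditions
    (hdiag1 : ∀ x ∈ Set.Icc (0 : ℝ) 1, (lam + μ) * Kuv x x = -ηp x)
    (hdiag2 : ∀ x ∈ Set.Icc (0 : ℝ) 1, (lam + μ) * Kvu x x = ηm x)
    -- (iii) ODEs for γα, γβ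
    (hγode1 : ∀ x ∈ Set.Icc (0 : ℝ) 1,
      lam • γα' x + Aᵀ.mulVec (γα x) + (lam * Kuu x 0) • M = 0)
    (hγode2 : ∀ x ∈ Set.Icc (0 : ℝ) 1,
      -μ • γβ' x + Aᵀ.mulVec (γβ x) + (lam * Kvu x 0) • M = 0)
    -- (iv) boundary conditions at y = 0
    (hbc1 : ∀ x ∈ Set.Icc (0 : ℝ) 1,
      lam * q * Kuu x 0 - μ * Kuv x 0 + γα x ⬝ᵥ B = 0)
    (hbc2 : ∀ x ∈ Set.Icc (0 : ℝ) 1,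
      lam * q * Kvu x 0 - μ * Kvv x 0 + γβ x ⬝ᵥ B = 0)
    -- (v) initial conditions for γα, γβ
    (hγα0 : γα 0 = -M) (hγβ0 : γβ 0 = 0)
    -- the original coupled system: u, v continuously differentiable, X differentiable
    (u v ut ux vt vx : ℝ → ℝ → ℝ) (X : ℝ → Fin n → ℝ)
    (hut : ∀ t : ℝ, 0 ≤ t → ∀ x ∈ Set.Icc (0 : ℝ) 1,
      HasDerivWithinAt (fun τ => u τ x) (ut t x) (Set.Ici 0) t)
    (hux : ∀ t : ℝ, 0 ≤ t → ∀ x ∈ Set.Icc (0 : ℝ) 1,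
      HasDerivWithinAt (fun ξ => u t ξ) (ux t x) (Set.Icc 0 1) x)
    (hvt : ∀ t : ℝ, 0 ≤ t → ∀ x ∈ Set.Icc (0 : ℝ) 1,
      HasDerivWithinAt (fun τ => v τ x) (vt t x) (Set.Ici 0) t)
    (hvx : ∀ t : ℝ, 0 ≤ t → ∀ x ∈ Set.Icc (0 : ℝ) 1,
      HasDerivWithinAt (fun ξ => v t ξ) (vx t x) (Set.Icc 0 1) x)
    (huc : ∀ F ∈ ({u, v, ut, ux, vt, vx} : Set (ℝ → ℝ → ℝ)),
      ContinuousOn (fun p : ℝ × ℝ => F p.1 p.2) (Set.Ici 0 ×ˢ Set.Icc 0 1))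
    (hpde1 : ∀ t : ℝ, 0 ≤ t → ∀ x ∈ Set.Icc (0 : ℝ) 1,
      ut t x + lam * ux t x = ηp x * v t x)
    (hpde2 : ∀ t : ℝ, 0 ≤ t → ∀ x ∈ Set.Icc (0 : ℝ) 1,
      vt t x - μ * vx t x = ηm x * u t x)
    (hX : ∀ t : ℝ, 0 ≤ t →
      HasDerivWithinAt X (A.mulVec (X t) + v t 0 • B) (Set.Ici 0) t)
    (hbdry : ∀ t : ℝ, 0 ≤ t → u t 0 = q * v t 0 + M ⬝ᵥ X t)
    -- the backstepping transformation
    (α β : ℝ → ℝ → ℝ)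
    (hα : α = fun t x => u t x
      + (∫ y in (0 : ℝ)..x, (Kuu x y * u t y + Kuv x y * v t y)) + γα x ⬝ᵥ X t)
    (hβ : β = fun t x => v t x
      + (∫ y in (0 : ℝ)..x, (Kvu x y * u t y + Kvv x y * v t y)) + γβ x ⬝ᵥ X t) :
    ∀ t : ℝ, 0 < t → ∀ x ∈ Set.Icc (0 : ℝ) 1,
      (∃ pt px : ℝ, HasDerivAt (fun τ => α τ x) pt t ∧
        HasDerivWithinAt (fun ξ => α t ξ) px (Set.Icc 0 1) x ∧ pt + lam * px = 0) ∧
      (∃ pt px : ℝ, HasDerivAt (fun τ => β τ x) pt t ∧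
        HasDerivWithinAt (fun ξ => β t ξ) px (Set.Icc 0 1) x ∧ pt - μ * px = 0) ∧
      β t 0 = v t 0 ∧ α t 0 = q * β t 0 := by
  intro t ht x hx
  subst hα hβ
  simp only [Set.mem_insert_iff, Set.mem_singleton_iff, forall_eq_or_imp, forall_eq] at hKc
  obtain ⟨c1, c2, c3, c4, c5, c6, c7, c8, c9, c10, c11, c12⟩ := hKc
  have h1 := backstepping_component_transport (c := lam) (w := u) (wt := ut) (wx := ux)
    hKuux hKuvx hKuuy hKuvy
    (by simp only [Set.mem_insert_iff, Set.mem_singleton_iff, forall_eq_or_imp, forall_eq]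
        exact ⟨c1, c2, c5, c6, c9, c10⟩)
    hγα hkeq1 hkeq2 hγode1 hbc1 hut hux hvt hvx huc hpde1 hpde2 hX hbdry ht hx
    (hut t ht.le x hx) (hux t ht.le x hx)
    (by linear_combination hpde1 t ht.le x hx + v t x * hdiag1 x hx)
  have h2 := backstepping_component_transport (c := -μ) (w := v) (wt := vt) (wx := vx)
    hKvux hKvvx hKvuy hKvvy
    (by simp only [Set.mem_insert_iff, Set.mem_singleton_iff, forall_eq_or_imp, forall_eq]
        exact ⟨c3, c4, c7, c8, c11, c12⟩)
    hγβ hkeq3 hkeq4 hγode2 hbc2 hut hux hvt hvx huc hpde1 hpde2 hX hbdry ht hx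
    (hvt t ht.le x hx) (hvx t ht.le x hx)
    (by linear_combination hpde2 t ht.le x hx - u t x * hdiag2 x hx)
  refine ⟨h1, ?_, ?_, ?_⟩
  · obtain ⟨pt, px, hpt, hpx, h⟩ := h2
    exact ⟨pt, px, hpt, hpx, by linarith⟩
  · simp [hγβ0]
  · simp [hγα0, hγβ0, hbdry t ht.le]
end

section
/- Let n ≥ 1 and T > 0. Let A be a real n×n matrix, B̄ ∈ ℝⁿ, Q̄ : [0,T] → ℝ^{n×n} continuous with each Q̄(t) symmetric, R : [0,T] → ℝ continuous with R(t) > 0 for all t, and r : [0,T] → ℝⁿ continuous. Let P : [0,T] → ℝ^{n×n} be differentiable with each P(t) symmetric, P(T) = 0, and P′(t) = −AᵀP(t) − P(t)A − Q̄(t) + R(t)⁻¹ (P(t)B̄)(P(t)B̄)ᵀ for all t ∈ [0,T], where (P(t)B̄)(P(t)B̄)ᵀ is the outer product of the vector P(t)B̄ with itself. Let φ : [0,T] → ℝⁿ be differentiable with φ(T) = 0 and φ′(t) = R(t)⁻¹ (B̄·φ(t)) (P(t)B̄) − Aᵀφ(t) − P(t) r(t). Let V : [0,T] → ℝ be continuous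 and Y : [0,T] → ℝⁿ differentiable with Y′(t) = A Y(t) + V(t)·B̄ + r(t). Then ∫₀^T ( Y(t)·(Q̄(t)Y(t)) + R(t) V(t)² ) dt = Y(0)·(P(0)Y(0)) + 2 φ(0)·Y(0) + ∫₀^T R(t) ( V(t) + R(t)⁻¹ B̄·(P(t)Y(t) + φ(t)) )² dt + ∫₀^T ( 2 φ(t)·r(t) − R(t)⁻¹ (B̄·φ(t))² ) dt. -/
open Matrix MeasureTheory intervalIntegral

attribute [local instance] Matrix.normedAddCommGroup Matrix.normedSpace

lemma HasDerivWithinAt.dotProduct {ι : Type*} [Fintype ι] {f g : ℝ → ι → ℝ} {f' g' : ι → ℝ}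
    {s : Set ℝ} {t : ℝ} (hf : HasDerivWithinAt f f' s t) (hg : HasDerivWithinAt g g' s t) :
    HasDerivWithinAt (fun x => f x ⬝ᵥ g x) (f' ⬝ᵥ g t + f t ⬝ᵥ g') s t := by
  rw [hasDerivWithinAt_pi] at hf hg
  simp only [_root_.dotProduct, ← Finset.sum_add_distrib]
  exact HasDerivWithinAt.fun_sum fun i _ => (hf i).fun_mul (hg i)

lemma HasDerivWithinAt.matrix_mulVec {ι κ : Type*} [Fintype ι] [Fintype κ]
    {M : ℝ → Matrix ι κ ℝ} {M' : Matrix ι κ ℝ} {g : ℝ → κ → ℝ} {g' : κ → ℝ}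
    {s : Set ℝ} {t : ℝ} (hM : HasDerivWithinAt M M' s t) (hg : HasDerivWithinAt g g' s t) :
    HasDerivWithinAt (fun x => (M x).mulVec (g x)) (M'.mulVec (g t) + (M t).mulVec g') s t :=
  hasDerivWithinAt_pi.2 fun i => (hasDerivWithinAt_pi.1 hM i).dotProduct hg

lemma Matrix.IsSymm.dotProduct_mulVec_comm {ι : Type*} [Fintype ι] {M : Matrix ι ι ℝ}
    (hM : M.IsSymm) (u v : ι → ℝ) : u ⬝ᵥ M.mulVec v = v ⬝ᵥ M.mulVec u := by
  rw [dotProduct_mulVec, ← mulVec_transpose, hM.eq, dotProduct_comm]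

/-- The derivative of `Y ⬝ P Y + 2 φ ⬝ Y` along the Riccati flow, as a completed square. -/
lemma riccati_completion_of_squares {ι : Type*} [Fintype ι] {A P Q : Matrix ι ι ℝ}
    (hP : P.IsSymm) {R : ℝ} (hR : R ≠ 0) (b r φ y : ι → ℝ) (v : ℝ) :
    (A.mulVec y + v • b + r) ⬝ᵥ P.mulVec y
        + y ⬝ᵥ ((-(Aᵀ * P) - P * A - Q
            + R⁻¹ • Matrix.vecMulVec (P.mulVec b) (P.mulVec b)).mulVec y
          + P.mulVec (A.mulVec y + v • b + r))
        + 2 * (((R⁻¹ * (b ⬝ᵥ φ)) • P.mulVec b - Aᵀ.mulVec φ - P.mulVec r) ⬝ᵥ y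
          + φ ⬝ᵥ (A.mulVec y + v • b + r)) =
      R * (v + R⁻¹ * (b ⬝ᵥ (P.mulVec y + φ))) ^ 2
        + (2 * (φ ⬝ᵥ r) - R⁻¹ * (b ⬝ᵥ φ) ^ 2)
        - (y ⬝ᵥ Q.mulVec y + R * v ^ 2) := by
  have hA (w : ι → ℝ) : y ⬝ᵥ Aᵀ.mulVec w = w ⬝ᵥ A.mulVec y := by
    rw [mulVec_transpose, dotProduct_comm, ← dotProduct_mulVec]
  have hout : y ⬝ᵥ (vecMulVec (P.mulVec b) (P.mulVec b)).mulVec y = (b ⬝ᵥ P.mulVec y) ^ 2 := by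
    rw [vecMulVec_mulVec, op_smul_eq_smul, dotProduct_smul, smul_eq_mul,
      dotProduct_comm (P.mulVec b) y, hP.dotProduct_mulVec_comm y b, sq]
  simp only [add_mulVec, sub_mulVec, neg_mulVec, smul_mulVec, mulVec_add, mulVec_smul,
    dotProduct_add, add_dotProduct, dotProduct_sub, sub_dotProduct, dotProduct_neg,
    dotProduct_smul, smul_dotProduct, smul_eq_mul, ← mulVec_mulVec, hA, hout]
  rw [dotProduct_comm (P.mulVec b) y, dotProduct_comm (Aᵀ.mulVec φ) y,
    dotProduct_comm (P.mulVec r) y, hA, hP.dotProduct_mulVec_comm y b,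
    hP.dotProduct_mulVec_comm y r, hP.dotProduct_mulVec_comm y (A.mulVec y),
    dotProduct_comm (P.mulVec y) (A.mulVec y), dotProduct_comm φ b]
  field_simp
  ring

lemma ContinuousOn.vec_dotProduct {ι : Type*} [Fintype ι] {f g : ℝ → ι → ℝ} {s : Set ℝ}
    (hf : ContinuousOn f s) (hg : ContinuousOn g s) : ContinuousOn (fun x => f x ⬝ᵥ g x) s := by
  rw [continuousOn_pi] at hf hg
  exact continuousOn_finsetSum _ fun i _ => (hf i).mul (hg i)

lemma ContinuousOn.matrix_mulVec {ι κ : Type*} [Fintype κ] {M : ℝ → Matrix ι κ ℝ}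
    {g : ℝ → κ → ℝ} {s : Set ℝ} (hM : ContinuousOn M s) (hg : ContinuousOn g s) :
    ContinuousOn (fun x => (M x).mulVec (g x)) s :=
  continuousOn_pi.2 fun i => (continuousOn_pi.1 hM i).vec_dotProduct hg

/-- **Completion-of-squares identity for the linear-quadratic cost.**
If `P` solves the matrix Riccati ODE with `P(T) = 0`, `φ` the associated affine
correction with `φ(T) = 0`, and `Y′ = AY + V•B̄ + r`, then
`∫₀ᵀ (Y⬝Q̄Y + R V²) = Y(0)⬝P(0)Y(0) + 2 φ(0)⬝Y(0)
  + ∫₀ᵀ R (V + R⁻¹ B̄⬝(PY + φ))² + ∫₀ᵀ (2 φ⬝r − R⁻¹ (B̄⬝φ)²)`. -/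
theorem lq_completion_of_squares
    (n : ℕ) (hn : 1 ≤ n) (T : ℝ) (hT : 0 < T)
    (A : Matrix (Fin n) (Fin n) ℝ) (Bb : Fin n → ℝ)
    (Qb : ℝ → Matrix (Fin n) (Fin n) ℝ)
    (hQc : ContinuousOn Qb (Set.Icc 0 T))
    (hQsymm : ∀ t ∈ Set.Icc (0 : ℝ) T, (Qb t).IsSymm)
    (R : ℝ → ℝ) (hRc : ContinuousOn R (Set.Icc 0 T))
    (hRpos : ∀ t ∈ Set.Icc (0 : ℝ) T, 0 < R t)
    (r : ℝ → Fin n → ℝ) (hrc : ContinuousOn r (Set.Icc 0 T))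
    (P : ℝ → Matrix (Fin n) (Fin n) ℝ)
    (hPsymm : ∀ t ∈ Set.Icc (0 : ℝ) T, (P t).IsSymm) (hPT : P T = 0)
    (hP : ∀ t ∈ Set.Icc (0 : ℝ) T,
      HasDerivWithinAt P
        (-(Aᵀ * P t) - P t * A - Qb t
          + (R t)⁻¹ • Matrix.vecMulVec ((P t).mulVec Bb) ((P t).mulVec Bb))
        (Set.Icc 0 T) t)
    (φ : ℝ → Fin n → ℝ) (hφT : φ T = 0)
    (hφ : ∀ t ∈ Set.Icc (0 : ℝ) T,
      HasDerivWithinAt φ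
        (((R t)⁻¹ * (Bb ⬝ᵥ φ t)) • (P t).mulVec Bb
          - Aᵀ.mulVec (φ t) - (P t).mulVec (r t))
        (Set.Icc 0 T) t)
    (V : ℝ → ℝ) (hV : ContinuousOn V (Set.Icc 0 T))
    (Y : ℝ → Fin n → ℝ)
    (hY : ∀ t ∈ Set.Icc (0 : ℝ) T,
      HasDerivWithinAt Y (A.mulVec (Y t) + V t • Bb + r t) (Set.Icc 0 T) t) :
    ∫ t in (0 : ℝ)..T, (Y t ⬝ᵥ (Qb t).mulVec (Y t) + R t * V t ^ 2) =
      Y 0 ⬝ᵥ (P 0).mulVec (Y 0) + 2 * (φ 0 ⬝ᵥ Y 0)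
        + (∫ t in (0 : ℝ)..T,
            R t * (V t + (R t)⁻¹ * (Bb ⬝ᵥ ((P t).mulVec (Y t) + φ t))) ^ 2)
        + ∫ t in (0 : ℝ)..T,
            (2 * (φ t ⬝ᵥ r t) - (R t)⁻¹ * (Bb ⬝ᵥ φ t) ^ 2) := by
  have hRne : ∀ t ∈ Set.Icc (0 : ℝ) T, R t ≠ 0 := fun t ht => (hRpos t ht).ne'
  have hPc : ContinuousOn P (Set.Icc 0 T) := fun t ht => (hP t ht).continuousWithinAt
  have hφc : ContinuousOn φ (Set.Icc 0 T) := fun t ht => (hφ t ht).continuousWithinAt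
  have hYc : ContinuousOn Y (Set.Icc 0 T) := fun t ht => (hY t ht).continuousWithinAt
  have hBc : ContinuousOn (fun _ : ℝ => Bb) (Set.Icc 0 T) := continuousOn_const
  have hRic := hRc.inv₀ hRne
  have hcost : ContinuousOn (fun t => Y t ⬝ᵥ (Qb t).mulVec (Y t) + R t * V t ^ 2)
      (Set.Icc 0 T) :=
    (hYc.vec_dotProduct (hQc.matrix_mulVec hYc)).add (hRc.mul (hV.pow 2))
  have hsquare : ContinuousOn
      (fun t => R t * (V t + (R t)⁻¹ * (Bb ⬝ᵥ ((P t).mulVec (Y t) + φ t))) ^ 2)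
      (Set.Icc 0 T) :=
    hRc.mul ((hV.add (hRic.mul
      (hBc.vec_dotProduct ((hPc.matrix_mulVec hYc).add hφc)))).pow 2)
  have hrest : ContinuousOn (fun t => 2 * (φ t ⬝ᵥ r t) - (R t)⁻¹ * (Bb ⬝ᵥ φ t) ^ 2)
      (Set.Icc 0 T) :=
    (continuousOn_const.mul (hφc.vec_dotProduct hrc)).sub
      (hRic.mul ((hBc.vec_dotProduct hφc).pow 2))
  have hderiv : ∀ t ∈ Set.Icc (0 : ℝ) T,
      HasDerivWithinAt (fun t => Y t ⬝ᵥ (P t).mulVec (Y t) + 2 * (φ t ⬝ᵥ Y t))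
        (R t * (V t + (R t)⁻¹ * (Bb ⬝ᵥ ((P t).mulVec (Y t) + φ t))) ^ 2
          + (2 * (φ t ⬝ᵥ r t) - (R t)⁻¹ * (Bb ⬝ᵥ φ t) ^ 2)
          - (Y t ⬝ᵥ (Qb t).mulVec (Y t) + R t * V t ^ 2)) (Set.Icc 0 T) t := by
    intro t ht
    rw [← riccati_completion_of_squares (A := A) (hPsymm t ht) (hRne t ht)]
    exact ((hY t ht).dotProduct ((hP t ht).matrix_mulVec (hY t ht))).fun_add
      (((hφ t ht).dotProduct (hY t ht)).const_mul 2)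
  rw [← Set.uIcc_of_le hT.le] at hcost hsquare hrest
  have hcost_int := hcost.intervalIntegrable (μ := volume)
  have hsquare_int := hsquare.intervalIntegrable (μ := volume)
  have hrest_int := hrest.intervalIntegrable (μ := volume)
  have hFTC := integral_eq_sub_of_hasDerivAt_of_le hT.le
    (fun t ht => (hderiv t ht).continuousWithinAt)
    (fun t ht => (hderiv t (Set.Ioo_subset_Icc_self ht)).hasDerivAt (Icc_mem_nhds ht.1 ht.2))
    ((hsquare_int.add hrest_int).sub hcost_int)
  rw [integral_sub (hsquare_int.add hrest_int) hcost_int,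
    integral_add hsquare_int hrest_int] at hFTC
  simp only [hPT, hφT, zero_mulVec, dotProduct_zero, zero_dotProduct, mul_zero, add_zero] at hFTC
  linarith
end
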